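/- arXiv:1908.11554 — 2 statements merged into one kernel-verified Lean document; each statement's English description precedes it below -/
import Mathlib

section
/- Let a₁,…,aₙ be positive integers with W = Σᵢ aᵢ and aᵢ < W/2 for every i, and let H be the associated ASHG. If H admits an envy-free partition with social welfare at least 2W, then there exists S ⊆ {1,…,n} with Σ_{i∈S} aᵢ = W/2. -/
def IsPartitionFun {A : Type*} [Fintype A] [DecidableEq A] (P : A → Finset A) : Prop :=
  (∀ a, a ∈ P a) ∧ ∀ a b, b ∈ P a → P b = P a

def util {A : Type*} [Fintype A] [DecidableEq A] (w : A → A → ℚ) (P : A → Finset A) (a : A) : ℚ :=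
  ∑ b ∈ (P a).erase a, w a b

def welfare {A : Type*} [Fintype A] [DecidableEq A] (w : A → A → ℚ) (P : A → Finset A) : ℚ :=
  ∑ a, util w P a

/-- A partition is envy-free if no agent `u` envies an agent `x` of a different coalition,
i.e. `u` cannot strictly increase its utility by taking `x`'s place. -/
def EnvyFree {A : Type*} [Fintype A] [DecidableEq A] (w : A → A → ℚ) (P : A → Finset A) :
    Prop :=
  ∀ u x : A, P u ≠ P x → ∑ b ∈ (P x).erase x, w u b ≤ util w P u

/-- The weights of the ASHG `H` associated to positive integers `a₁, …, aₙ` with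
`W = Σᵢ aᵢ`: agents are `v₁, …, vₙ` (the `Sum.inl` part) and `u₁, u₂` (the `Sum.inr` part),
`w(vᵢ, u₁) = w(vᵢ, u₂) = aᵢ`, `w(u₁, u₂) = −2W − 1`, and all other weights `0`. -/
def Hw {n : ℕ} (a : Fin n → ℕ) : Fin n ⊕ Fin 2 → Fin n ⊕ Fin 2 → ℚ := fun x y =>
  match x, y with
  | Sum.inl i, Sum.inr _ => (a i : ℚ)
  | Sum.inr _, Sum.inl i => (a i : ℚ)
  | Sum.inr p, Sum.inr q => if p = q then 0 else -2 * (∑ t, (a t : ℚ)) - 1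
  | Sum.inl _, Sum.inl _ => 0

theorem IsPartitionFun.mem_comm {A : Type*} [Fintype A] [DecidableEq A] {P : A → Finset A}
    (hP : IsPartitionFun P) {x y : A} : x ∈ P y ↔ y ∈ P x :=
  ⟨fun h => hP.2 y x h ▸ hP.1 y, fun h => hP.2 x y h ▸ hP.1 x⟩

theorem sum_erase_inr_Hw {n : ℕ} (a : Fin n → ℕ) (s : Finset (Fin n ⊕ Fin 2)) (p q : Fin 2) :
    ∑ b ∈ s.erase (Sum.inr q), Hw a (Sum.inr p) b =
      (∑ i with Sum.inl i ∈ s, (a i : ℚ)) +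
        ∑ r, if r ≠ q ∧ r ≠ p ∧ Sum.inr r ∈ s then -2 * (∑ t, (a t : ℚ)) - 1 else 0 := by
  rw [← Finset.univ_inter (s.erase _), ← Finset.sum_ite_mem, Fintype.sum_sum_type,
    Finset.sum_filter]
  congr 1
  · simp [Hw]
  · refine Finset.sum_congr rfl fun r _ => ?_
    by_cases h : p = r <;> by_cases h' : r = q <;> simp [Hw, h, h', eq_comm (a := r) (b := p)]

theorem util_inl_Hw {n : ℕ} (a : Fin n → ℕ) {P : Fin n ⊕ Fin 2 → Finset (Fin n ⊕ Fin 2)}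
    (hP : IsPartitionFun P) (i : Fin n) :
    util (Hw a) P (Sum.inl i) =
      ∑ p, if Sum.inl i ∈ P (Sum.inr p) then (a i : ℚ) else 0 := by
  rw [util, ← Finset.univ_inter (Finset.erase _ _), ← Finset.sum_ite_mem, Fintype.sum_sum_type]
  simp [Hw, hP.mem_comm (y := Sum.inl i)]

theorem welfare_Hw {n : ℕ} (a : Fin n → ℕ) {P : Fin n ⊕ Fin 2 → Finset (Fin n ⊕ Fin 2)}
    (hP : IsPartitionFun P) :
    welfare (Hw a) P =
      2 * (∑ i with Sum.inl i ∈ P (Sum.inr 0), (a i : ℚ)) +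
      2 * (∑ i with Sum.inl i ∈ P (Sum.inr 1), (a i : ℚ)) +
        if Sum.inr 0 ∈ P (Sum.inr 1) then 2 * (-2 * (∑ t, (a t : ℚ)) - 1) else 0 := by
  rw [welfare, Fintype.sum_sum_type]
  simp only [util_inl_Hw a hP, Fin.sum_univ_two]
  simp only [util, sum_erase_inr_Hw, Fin.sum_univ_two, Finset.sum_add_distrib, Finset.sum_filter]
  have hc := hP.mem_comm (x := Sum.inr 1) (y := Sum.inr 0)
  by_cases h : (Sum.inr 0 : Fin n ⊕ Fin 2) ∈ P (Sum.inr 1) <;> simp [h, hc] <;> ring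

/-- if `H` admits an envy-free partition with social welfare at least `2W`,
then there exists `S ⊆ {1,…,n}` with `Σ_{i∈S} aᵢ = W/2`. -/
theorem exists_half_sum_subset_of_envy_free {n : ℕ} (a : Fin n → ℕ) (hpos : ∀ i, 0 < a i)
    (W : ℚ) (hW : W = ∑ i, (a i : ℚ)) (hsmall : ∀ i, (a i : ℚ) < W / 2)
    (P : Fin n ⊕ Fin 2 → Finset (Fin n ⊕ Fin 2)) (hP : IsPartitionFun P)
    (hEF : EnvyFree (Hw a) P) (hwel : 2 * W ≤ welfare (Hw a) P) :
    ∃ S : Finset (Fin n), ∑ i ∈ S, (a i : ℚ) = W / 2 := by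
  have hle (S : Finset (Fin n)) : ∑ i ∈ S, (a i : ℚ) ≤ W :=
    hW ▸ Finset.sum_le_univ_sum_of_nonneg fun i => Nat.cast_nonneg _
  have hW0 : 0 ≤ W := by simpa using hle ∅
  rw [welfare_Hw a hP, ← hW] at hwel
  by_cases h : (Sum.inr 0 : Fin n ⊕ Fin 2) ∈ P (Sum.inr 1)
  · rw [if_pos h] at hwel
    linarith [hle {i | Sum.inl i ∈ P (Sum.inr 0)}, hle {i | Sum.inl i ∈ P (Sum.inr 1)}]
  have h' : (Sum.inr 1 : Fin n ⊕ Fin 2) ∉ P (Sum.inr 0) := mt hP.mem_comm.1 h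
  have hne : P (Sum.inr 0) ≠ P (Sum.inr 1) := fun e => h (e ▸ hP.1 _)
  have h01 := hEF _ _ hne
  have h10 := hEF _ _ hne.symm
  simp only [util, sum_erase_inr_Hw, Fin.sum_univ_two] at h01 h10
  simp only [h, h', ne_eq, not_true_eq_false, and_false, false_and, if_false, add_zero] at h01 h10
  have hdisj : Disjoint ({i | Sum.inl i ∈ P (Sum.inr 0)} : Finset (Fin n))
      ({i | Sum.inl i ∈ P (Sum.inr 1)} : Finset (Fin n)) := by
    refine Finset.disjoint_filter.2 fun i _ h0 h1 => hne ?_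
    rw [← hP.2 _ _ h0, hP.2 _ _ h1]
  have hunion := hle (({i | Sum.inl i ∈ P (Sum.inr 0)} : Finset (Fin n)) ∪
      ({i | Sum.inl i ∈ P (Sum.inr 1)} : Finset (Fin n)))
  rw [Finset.sum_union hdisj] at hunion
  rw [if_neg h] at hwel
  exact ⟨({i | Sum.inl i ∈ P (Sum.inr 0)} : Finset (Fin n)), by linarith⟩
end

section
/- Let G = (V,E,w) be a finite simple graph with integer edge weights and V = {v₁,…,vₙ}, n ≥ 1, and let G′ be the associated symmetric ASHG. For every 2-partition (C₁,C₂) of V into two (possibly empty) sets, the partition {C₁ ∪ P_A, C₂ ∪ P_B} of the agents of G′ is Nash-stable if and only if (C₁,C₂) is a locally optimal cut of G under the flip neighborhood. -/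
/-- A partition is Nash-stable if no agent `u` can strictly increase its utility by
moving to another existing coalition or to the empty coalition. -/
def NashStable {A : Type*} [Fintype A] [DecidableEq A] (w : A → A → ℚ) (P : A → Finset A) :
    Prop :=
  ∀ u : A, ∀ C : Finset A, (C = ∅ ∨ ∃ v, C = P v) → C ≠ P u →
    ∑ b ∈ C, w u b ≤ util w P u

/-- The coalition partition induced by a classification function `f`:
the coalition of `x` is the set of agents with the same `f`-value as `x`. -/
def classPart {A κ : Type*} [Fintype A] [DecidableEq A] [DecidableEq κ] (f : A → κ) :
    A → Finset A := fun x => Finset.univ.filter (fun y => f y = f x)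

/-- `W = Σ_{e∈E} |w_e| + 1` (each edge appears twice in the double sum, whence the `/2`). -/
def bigW {n : ℕ} (G : SimpleGraph (Fin n)) [DecidableRel G.Adj]
    (wG : Fin n → Fin n → ℤ) : ℚ :=
  (∑ x, ∑ y, if G.Adj x y then |(wG x y : ℚ)| else 0) / 2 + 1

/-- The weights of the symmetric ASHG `G′` associated to an integer-edge-weighted graph `G`
on `V = {v₁,…,vₙ}` (with `W = Σ_{e∈E}|w_e|+1` and `M = nW+1`): agents are
`V ⊕ (P_A ⊕ P_B)` where `P_A = {p^A_1,…,p^A_{n+1}}`, `P_B = {p^B_1,…,p^B_{n+1}}`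
(0-indexed by `Fin (n+1)`); `w′(x,y) = −w_{xy}` on edges of `G`,
`w′(p^A_i,p^A_{i+1}) = w′(p^B_i,p^B_{i+1}) = i(W+1)` for `1 ≤ i ≤ n`,
`w′(p^A_i,v_i) = w′(p^B_i,v_i) = W` for `1 ≤ i ≤ n`, `w′(p^A_{n+1},p^B_{n+1}) = −3M`,
and all other weights `0`. -/
def wPrime {n : ℕ} (G : SimpleGraph (Fin n)) [DecidableRel G.Adj]
    (wG : Fin n → Fin n → ℤ) :
    Fin n ⊕ (Fin (n + 1) ⊕ Fin (n + 1)) → Fin n ⊕ (Fin (n + 1) ⊕ Fin (n + 1)) → ℚ :=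
  fun p q =>
    let W : ℚ := bigW G wG
    let M : ℚ := (n : ℚ) * W + 1
    match p, q with
    | Sum.inl x, Sum.inl y => if G.Adj x y then -(wG x y : ℚ) else 0
    | Sum.inl x, Sum.inr (Sum.inl i) => if (i : ℕ) = (x : ℕ) then W else 0
    | Sum.inl x, Sum.inr (Sum.inr i) => if (i : ℕ) = (x : ℕ) then W else 0
    | Sum.inr (Sum.inl i), Sum.inl x => if (i : ℕ) = (x : ℕ) then W else 0
    | Sum.inr (Sum.inr i), Sum.inl x => if (i : ℕ) = (x : ℕ) then W else 0
    | Sum.inr (Sum.inl i), Sum.inr (Sum.inl j) =>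
        if (i : ℕ) + 1 = (j : ℕ) then ((i : ℕ) + 1 : ℚ) * (W + 1)
        else if (j : ℕ) + 1 = (i : ℕ) then ((j : ℕ) + 1 : ℚ) * (W + 1) else 0
    | Sum.inr (Sum.inr i), Sum.inr (Sum.inr j) =>
        if (i : ℕ) + 1 = (j : ℕ) then ((i : ℕ) + 1 : ℚ) * (W + 1)
        else if (j : ℕ) + 1 = (i : ℕ) then ((j : ℕ) + 1 : ℚ) * (W + 1) else 0
    | Sum.inr (Sum.inl i), Sum.inr (Sum.inr j) =>
        if (i : ℕ) = n ∧ (j : ℕ) = n then -3 * M else 0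
    | Sum.inr (Sum.inr i), Sum.inr (Sum.inl j) =>
        if (i : ℕ) = n ∧ (j : ℕ) = n then -3 * M else 0

/-- The cut weight of the 2-partition `(S, Sᶜ)` of the vertices of `G`. -/
def cutWeight {n : ℕ} (G : SimpleGraph (Fin n)) [DecidableRel G.Adj]
    (wG : Fin n → Fin n → ℤ) (S : Finset (Fin n)) : ℚ :=
  ∑ x ∈ S, ∑ y ∈ Sᶜ, if G.Adj x y then (wG x y : ℚ) else 0

/-- `(S, Sᶜ)` is a locally optimal cut of `G` under the flip neighbourhood: moving any
single vertex to the other side does not strictly increase the cut weight. -/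
def LocalOptCut {n : ℕ} (G : SimpleGraph (Fin n)) [DecidableRel G.Adj]
    (wG : Fin n → Fin n → ℤ) (S : Finset (Fin n)) : Prop :=
  ∀ v : Fin n,
    cutWeight G wG (if v ∈ S then S.erase v else insert v S) ≤ cutWeight G wG S

/-- The partition `{C₁ ∪ P_A, C₂ ∪ P_B}` of the agents of `G′` associated to the
2-partition `(C₁, C₂) = (S, Sᶜ)` of `V`. -/
def cutPart {n : ℕ} (S : Finset (Fin n)) :
    Fin n ⊕ (Fin (n + 1) ⊕ Fin (n + 1)) → Finset (Fin n ⊕ (Fin (n + 1) ⊕ Fin (n + 1))) :=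
  classPart (Sum.elim (fun x => decide (x ∈ S)) (Sum.elim (fun _ => true) (fun _ => false)))

/-- The total weight that `u` assigns to the agents of class `c`. -/
def classSum {A κ : Type*} [Fintype A] [DecidableEq κ] (w : A → A → ℚ) (f : A → κ)
    (c : κ) (u : A) : ℚ :=
  ∑ b, if f b = c then w u b else 0

/-- The weight of the pair `x, y` in `G`, zero off the edges. -/
def edgeWeight {n : ℕ} (G : SimpleGraph (Fin n)) [DecidableRel G.Adj]
    (wG : Fin n → Fin n → ℤ) (x y : Fin n) : ℚ :=
  if G.Adj x y then (wG x y : ℚ) else 0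

lemma sum_classPart {A κ : Type*} [Fintype A] [DecidableEq A] [DecidableEq κ]
    (w : A → A → ℚ) (f : A → κ) (u v : A) :
    ∑ b ∈ classPart f v, w u b = classSum w f (f v) u := by
  simp [classPart, classSum, Finset.sum_filter]

lemma util_classPart {A κ : Type*} [Fintype A] [DecidableEq A] [DecidableEq κ]
    (w : A → A → ℚ) (hw : ∀ u, w u u = 0) (f : A → κ) (u : A) :
    util w (classPart f) u = classSum w f (f u) u := by
  rw [util, Finset.sum_erase _ (hw u), sum_classPart]

lemma nashStable_classPart_iff {A κ : Type*} [Fintype A] [DecidableEq A] [DecidableEq κ]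
    (w : A → A → ℚ) (hw : ∀ u, w u u = 0) (f : A → κ) :
    NashStable w (classPart f) ↔ ∀ u, 0 ≤ classSum w f (f u) u ∧
      ∀ v, f v ≠ f u → classSum w f (f v) u ≤ classSum w f (f u) u := by
  have mem_self : ∀ v, v ∈ classPart f v := fun v => by simp [classPart]
  constructor
  · intro h u
    refine ⟨?_, fun v hv => ?_⟩
    · have h0 := h u ∅ (Or.inl rfl) (Finset.ne_empty_of_mem (mem_self u)).symm
      rwa [Finset.sum_empty, util_classPart w hw] at h0
    · have h1 := h u (classPart f v) (Or.inr ⟨v, rfl⟩) fun e => hv <| by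
        have hm := mem_self v
        rw [e] at hm
        simpa [classPart] using hm
      rwa [sum_classPart, util_classPart w hw] at h1
  · rintro h u C (rfl | ⟨v, rfl⟩) hC
    · rw [Finset.sum_empty, util_classPart w hw]
      exact (h u).1
    · rw [sum_classPart, util_classPart w hw]
      exact (h u).2 v fun e => hC (by simp [classPart, e])

section EdgeWeight

variable {n : ℕ} (G : SimpleGraph (Fin n)) [DecidableRel G.Adj] (wG : Fin n → Fin n → ℤ)

lemma edgeWeight_self (x : Fin n) : edgeWeight G wG x x = 0 := by
  simp [edgeWeight]

lemma edgeWeight_comm (hsymG : ∀ x y, wG x y = wG y x) (x y : Fin n) :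
    edgeWeight G wG x y = edgeWeight G wG y x := by
  simp [edgeWeight, G.adj_comm x y, hsymG x y]

lemma bigW_eq : bigW G wG = (∑ x, ∑ y, |edgeWeight G wG x y|) / 2 + 1 := by
  simp only [bigW, edgeWeight, apply_ite abs, abs_zero]

lemma one_le_bigW : 1 ≤ bigW G wG := by
  rw [bigW_eq]
  have : 0 ≤ ∑ x, ∑ y, |edgeWeight G wG x y| := by positivity
  linarith

lemma sum_edgeWeight_le_bigW (hsymG : ∀ x y, wG x y = wG y x) (v : Fin n)
    (T : Finset (Fin n)) : ∑ y ∈ T, edgeWeight G wG v y ≤ bigW G wG := by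
  have h1 : ∑ y ∈ T, edgeWeight G wG v y ≤ ∑ y, |edgeWeight G wG v y| :=
    (Finset.sum_le_sum fun y _ => le_abs_self _).trans
      (Finset.sum_le_univ_sum_of_nonneg fun y => abs_nonneg _)
  have h2 : ∑ y, |edgeWeight G wG v y| ≤
      ∑ x ∈ Finset.univ.erase v, ∑ y, |edgeWeight G wG x y| := by
    rw [← Finset.sum_erase Finset.univ (a := v) (by simp [edgeWeight_self])]
    refine Finset.sum_le_sum fun x _ => ?_
    rw [edgeWeight_comm G wG hsymG]
    exact Finset.single_le_sum (f := fun y => |edgeWeight G wG x y|)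
      (fun y _ => abs_nonneg _) (Finset.mem_univ v)
  have h3 := Finset.add_sum_erase Finset.univ (fun x => ∑ y, |edgeWeight G wG x y|)
    (Finset.mem_univ v)
  rw [bigW_eq]
  linarith

lemma cutWeight_insert (hsymG : ∀ x y, wG x y = wG y x) {v : Fin n} {T : Finset (Fin n)}
    (hv : v ∉ T) :
    cutWeight G wG (insert v T) + ∑ y ∈ T, edgeWeight G wG v y =
      cutWeight G wG T + ∑ y ∈ Tᶜ, edgeWeight G wG v y := by
  have hc : (insert v T)ᶜ = Tᶜ.erase v := Finset.compl_insert
  have hm : v ∈ Tᶜ := by simpa using hv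
  change (∑ x ∈ insert v T, ∑ y ∈ (insert v T)ᶜ, edgeWeight G wG x y) + _ =
    (∑ x ∈ T, ∑ y ∈ Tᶜ, edgeWeight G wG x y) + _
  rw [Finset.sum_insert hv, hc, Finset.sum_erase _ (edgeWeight_self G wG v),
    add_assoc, ← Finset.sum_add_distrib, add_comm]
  congr 1
  refine Finset.sum_congr rfl fun x _ => ?_
  rw [edgeWeight_comm G wG hsymG v x, Finset.sum_erase_add _ _ hm]

lemma cutWeight_flip_le_iff (hsymG : ∀ x y, wG x y = wG y x) (S : Finset (Fin n))
    (v : Fin n) :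
    cutWeight G wG (if v ∈ S then S.erase v else insert v S) ≤ cutWeight G wG S ↔
      if v ∈ S then ∑ y ∈ S, edgeWeight G wG v y ≤ ∑ y ∈ Sᶜ, edgeWeight G wG v y
      else ∑ y ∈ Sᶜ, edgeWeight G wG v y ≤ ∑ y ∈ S, edgeWeight G wG v y := by
  split_ifs with hv
  · have h := cutWeight_insert G wG hsymG (Finset.notMem_erase v S)
    have hc : (S.erase v)ᶜ = insert v Sᶜ := Finset.compl_erase
    rw [Finset.insert_erase hv, Finset.sum_erase _ (edgeWeight_self G wG v), hc,
      Finset.sum_insert (by simpa using hv), edgeWeight_self, zero_add] at h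
    constructor <;> intro _ <;> linarith
  · have h := cutWeight_insert G wG hsymG hv
    constructor <;> intro _ <;> linarith

end EdgeWeight

section CutPart

variable {n : ℕ} (G : SimpleGraph (Fin n)) [DecidableRel G.Adj] (wG : Fin n → Fin n → ℤ)
  (S : Finset (Fin n))

/-- The side of the partition `{C₁ ∪ P_A, C₂ ∪ P_B}` an agent lies on (`true` for the first). -/
def cutSide : Fin n ⊕ (Fin (n + 1) ⊕ Fin (n + 1)) → Bool :=
  Sum.elim (fun x => decide (x ∈ S)) (Sum.elim (fun _ => true) (fun _ => false))

lemma wPrime_self (u : Fin n ⊕ (Fin (n + 1) ⊕ Fin (n + 1))) : wPrime G wG u u = 0 := by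
  rcases u with x | i | i <;> simp [wPrime]

lemma sum_ite_val_eq_castSucc (x : Fin n) (W : ℚ) :
    ∑ i : Fin (n + 1), (if (i : ℕ) = (x : ℕ) then W else 0) = W := by
  rw [Finset.sum_eq_single x.castSucc]
  · simp
  · intro i _ hi
    exact if_neg fun h => hi (Fin.ext h)
  · simp

lemma classSum_vertex_true (v : Fin n) :
    classSum (wPrime G wG) (cutSide S) true (Sum.inl v) =
      bigW G wG - ∑ y ∈ S, edgeWeight G wG v y := by
  have h : ∀ y, (if y ∈ S then if G.Adj v y then -(wG v y : ℚ) else 0 else 0) =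
      -(if y ∈ S then edgeWeight G wG v y else 0) := by
    intro y; unfold edgeWeight; split_ifs <;> simp
  simp only [classSum, Fintype.sum_sum_type, cutSide, Sum.elim_inl, Sum.elim_inr, wPrime,
    decide_eq_true_eq, h, if_true, Bool.false_eq_true, if_false, Finset.sum_const_zero,
    sum_ite_val_eq_castSucc, Finset.sum_neg_distrib]
  rw [← Finset.sum_filter, Finset.filter_univ_mem]
  ring

lemma classSum_vertex_false (v : Fin n) :
    classSum (wPrime G wG) (cutSide S) false (Sum.inl v) =
      bigW G wG - ∑ y ∈ Sᶜ, edgeWeight G wG v y := by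
  have h : ∀ y, (if y ∉ S then if G.Adj v y then -(wG v y : ℚ) else 0 else 0) =
      -(if y ∈ Sᶜ then edgeWeight G wG v y else 0) := by
    intro y; unfold edgeWeight; split_ifs <;> simp_all
  simp only [classSum, Fintype.sum_sum_type, cutSide, Sum.elim_inl, Sum.elim_inr, wPrime,
    decide_eq_false_iff_not, h, if_true, reduceCtorEq, if_false, Finset.sum_const_zero,
    sum_ite_val_eq_castSucc, Finset.sum_neg_distrib]
  rw [← Finset.sum_filter, Finset.filter_univ_mem]
  ring

/-- The agent `p^A_{i+1}` (for `c = true`) or `p^B_{i+1}` (for `c = false`). -/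
def pathAgent (c : Bool) (i : Fin (n + 1)) : Fin n ⊕ (Fin (n + 1) ⊕ Fin (n + 1)) :=
  Sum.inr (if c then Sum.inl i else Sum.inr i)

lemma cutSide_pathAgent (c : Bool) (i : Fin (n + 1)) : cutSide S (pathAgent c i) = c := by
  cases c <;> rfl

lemma ite_wPrime_pathAgent_nonneg (c : Bool) (i : Fin (n + 1))
    (b : Fin n ⊕ (Fin (n + 1) ⊕ Fin (n + 1))) :
    0 ≤ if cutSide S b = c then wPrime G wG (pathAgent c i) b else 0 := by
  have hW := one_le_bigW G wG
  have hW0 : 0 ≤ bigW G wG := by linarith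
  cases c <;> rcases b with x | j | j <;> simp only [cutSide, pathAgent, wPrime, Sum.elim_inl,
    Sum.elim_inr, if_true, reduceCtorEq, if_false, Bool.false_eq_true, le_refl] <;> split_ifs <;>
    positivity

lemma classSum_pathAgent_nonneg (c : Bool) (i : Fin (n + 1)) :
    0 ≤ classSum (wPrime G wG) (cutSide S) c (pathAgent c i) :=
  Finset.sum_nonneg fun b _ => ite_wPrime_pathAgent_nonneg G wG S c i b

lemma bigW_le_classSum_pathAgent (c : Bool) (i : Fin n) :
    bigW G wG ≤ classSum (wPrime G wG) (cutSide S) c (pathAgent c i.castSucc) := by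
  have hW := one_le_bigW G wG
  have h := Finset.single_le_sum
    (f := fun b => if cutSide S b = c then wPrime G wG (pathAgent c i.castSucc) b else 0)
    (fun b _ => ite_wPrime_pathAgent_nonneg G wG S c i.castSucc b)
    (Finset.mem_univ (pathAgent c i.succ))
  refine le_trans ?_ h
  have hi : (0 : ℚ) ≤ (i : ℕ) := Nat.cast_nonneg _
  have hp : wPrime G wG (pathAgent c i.castSucc) (pathAgent c i.succ) =
      ((i : ℕ) + 1 : ℚ) * (bigW G wG + 1) := by
    cases c <;> simp [pathAgent, wPrime]
  simp only [cutSide_pathAgent, if_true, hp]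
  nlinarith

lemma classSum_not_pathAgent_le (c : Bool) (i : Fin (n + 1)) :
    classSum (wPrime G wG) (cutSide S) (!c) (pathAgent c i) ≤
      ∑ x : Fin n, if (i : ℕ) = (x : ℕ) then bigW G wG else 0 := by
  have hW := one_le_bigW G wG
  have hM : -3 * ((n : ℚ) * bigW G wG + 1) ≤ 0 := by
    have : 0 ≤ (n : ℚ) * bigW G wG := by positivity
    linarith
  rw [classSum, Fintype.sum_sum_type]
  refine (add_le_add (Finset.sum_le_sum fun x _ => ?_)
    (Finset.sum_nonpos fun b _ => ?_)).trans_eq (add_zero _)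
  · have hx : wPrime G wG (pathAgent c i) (Sum.inl x) =
        if (i : ℕ) = (x : ℕ) then bigW G wG else 0 := by
      cases c <;> rfl
    rw [hx]
    split_ifs <;> linarith
  · cases c <;> rcases b with j | j <;> simp only [cutSide, pathAgent, wPrime, Sum.elim_inl,
      Sum.elim_inr, if_true, reduceCtorEq, if_false, Bool.false_eq_true, Bool.not_true,
      Bool.not_false, le_refl] <;> split_ifs <;> first | exact hM | exact le_rfl

lemma classSum_pathAgent_le (c : Bool) (i : Fin (n + 1)) :
    classSum (wPrime G wG) (cutSide S) (!c) (pathAgent c i) ≤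
      classSum (wPrime G wG) (cutSide S) c (pathAgent c i) := by
  refine (classSum_not_pathAgent_le G wG S c i).trans ?_
  induction i using Fin.lastCases with
  | last =>
    refine (Finset.sum_nonpos fun x _ => ?_).trans (classSum_pathAgent_nonneg G wG S c _)
    rw [if_neg (by simpa using x.isLt.ne')]
  | cast i =>
    refine le_trans (le_of_eq ?_) (bigW_le_classSum_pathAgent G wG S c i)
    simp [Fin.val_inj]

end CutPart

/-- for every 2-partition `(C₁,C₂) = (S,Sᶜ)` of `V`, the partition
`{C₁ ∪ P_A, C₂ ∪ P_B}` of the agents of `G′` is Nash-stable iff `(C₁,C₂)` is a locally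
optimal cut of `G` under the flip neighbourhood. -/
theorem nash_stable_iff_local_opt {n : ℕ} (hn : 1 ≤ n)
    (G : SimpleGraph (Fin n)) [DecidableRel G.Adj]
    (wG : Fin n → Fin n → ℤ) (hsymG : ∀ x y, wG x y = wG y x)
    (S : Finset (Fin n)) :
    NashStable (wPrime G wG) (cutPart S) ↔ LocalOptCut G wG S := by
  change NashStable (wPrime G wG) (classPart (cutSide S)) ↔ _
  rw [nashStable_classPart_iff _ (wPrime_self G wG)]
  have hle := sum_edgeWeight_le_bigW G wG hsymG
  constructor
  · intro h v
    rw [cutWeight_flip_le_iff G wG hsymG]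
    have hv := (h (Sum.inl v)).2
    split_ifs with hS
    · have h1 := hv (pathAgent false 0)
      simp only [cutSide_pathAgent, show cutSide S (Sum.inl v) = true by simp [cutSide, hS],
        classSum_vertex_true, classSum_vertex_false] at h1
      linarith [h1 (by decide)]
    · have h1 := hv (pathAgent true 0)
      simp only [cutSide_pathAgent, show cutSide S (Sum.inl v) = false by simp [cutSide, hS],
        classSum_vertex_true, classSum_vertex_false] at h1
      linarith [h1 (by decide)]
  · intro h
    have hpath : ∀ c i, 0 ≤ classSum (wPrime G wG) (cutSide S) (cutSide S (pathAgent c i))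
        (pathAgent c i) ∧ ∀ v, cutSide S v ≠ cutSide S (pathAgent c i) →
          classSum (wPrime G wG) (cutSide S) (cutSide S v) (pathAgent c i) ≤
            classSum (wPrime G wG) (cutSide S) (cutSide S (pathAgent c i)) (pathAgent c i) := by
      intro c i
      rw [cutSide_pathAgent]
      refine ⟨classSum_pathAgent_nonneg G wG S c i, fun v hv => ?_⟩
      rw [Bool.eq_not_of_ne hv]
      exact classSum_pathAgent_le G wG S c i
    rintro (v | i | i)
    · have hv := h v
      rw [cutWeight_flip_le_iff G wG hsymG] at hv
      split_ifs at hv with hS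
      · rw [show cutSide S (Sum.inl v) = true by simp [cutSide, hS], classSum_vertex_true]
        refine ⟨sub_nonneg.2 (hle v S), fun u hu => ?_⟩
        rw [Bool.eq_false_of_not_eq_true hu, classSum_vertex_false]
        linarith
      · rw [show cutSide S (Sum.inl v) = false by simp [cutSide, hS], classSum_vertex_false]
        refine ⟨sub_nonneg.2 (hle v Sᶜ), fun u hu => ?_⟩
        rw [Bool.eq_true_of_not_eq_false hu, classSum_vertex_true]
        linarith
    · exact hpath true i
    · exact hpath false i
end
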